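/- Let G be a finite abelian group and let n be an odd positive integer. For every cycle C ∈ C_n(G) with dC = 0 in the unnormalized bar complex of G with trivial ℤ-coefficients, there exist a positive integer r with r ≤ |G|^((n+1)·‖C‖₁) and a chain u ∈ C_{n+1}(G) such that d u = r • C − (r · ε(C)) • e_n and ‖u‖₁ ≤ (n+1) · |G|^((n+1)·‖C‖₁) · ‖C‖₁, where |G| is the order of G. -/

import Mathlib

/-- The differential of the unnormalized bar complex (inhomogeneous chains) of a group `G`
with trivial `ℤ`-coefficients, from degree `n + 1` to degree `n`: it sends the basis element
`[g₁|⋯|g_{n+1}]` to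
`[g₂|⋯|g_{n+1}] + ∑_{i=1}^{n} (−1)^i [g₁|⋯|g_i g_{i+1}|⋯|g_{n+1}] + (−1)^{n+1} [g₁|⋯|g_n]`. -/
noncomputable def barD (G : Type*) [Group G] (n : ℕ) :
    ((Fin (n + 1) → G) →₀ ℤ) →ₗ[ℤ] ((Fin n → G) →₀ ℤ) :=
  Finsupp.lsum ℤ fun g =>
    LinearMap.toSpanSingleton ℤ ((Fin n → G) →₀ ℤ)
      (Finsupp.single (fun i => g i.succ) 1
        + ∑ j : Fin (n + 1), ((-1 : ℤ) ^ ((j : ℕ) + 1)) •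
            Finsupp.single (j.contractNth (· * ·) g) 1)

/-- The sum of the coefficients of a chain. -/
def barEps {G : Type*} [Group G] {n : ℕ} (x : (Fin n → G) →₀ ℤ) : ℤ :=
  x.sum fun _ c => c

/-- The ℓ¹-norm (simplicial complexity) of a chain: the sum of the absolute values of its
coefficients. -/
def barNorm {G : Type*} [Group G] {n : ℕ} (x : (Fin n → G) →₀ ℤ) : ℕ :=
  x.sum fun _ c => c.natAbs

/-- The basis element `[1|1|⋯|1]` of the degree-`n` term of the bar complex. -/
noncomputable def barOne (G : Type*) [Group G] (n : ℕ) : (Fin n → G) →₀ ℤ :=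
  Finsupp.single (fun _ => (1 : G)) 1

section BarHelpers

variable {G : Type*}

theorem barD_single_aux [Group G] (n : ℕ) (g : Fin (n + 1) → G) :
    barD G n (Finsupp.single g 1) = Finsupp.single (fun i => g i.succ) 1
        + ∑ j : Fin (n + 1), ((-1 : ℤ) ^ ((j : ℕ) + 1)) •
            Finsupp.single (j.contractNth (· * ·) g) 1 := by
  simp [barD]

/-- The averaging homotopy `x ↦ ∑_g [g|x]`. -/
noncomputable def barH (G : Type*) [Group G] [Fintype G] (n : ℕ) :
    ((Fin n → G) →₀ ℤ) →ₗ[ℤ] ((Fin (n + 1) → G) →₀ ℤ) :=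
  Finsupp.lsum ℤ fun x =>
    LinearMap.toSpanSingleton ℤ ((Fin (n + 1) → G) →₀ ℤ)
      (∑ g : G, Finsupp.single (Fin.cons g x : Fin (n + 1) → G) 1)

theorem barH_single_aux [Group G] [Fintype G] (n : ℕ) (x : Fin n → G) :
    barH G n (Finsupp.single x 1) =
      ∑ g : G, Finsupp.single (Fin.cons g x : Fin (n + 1) → G) 1 := by
  simp [barH]

theorem contractNth_zero_cons_aux [Group G] (m : ℕ) (g : G) (x : Fin (m + 1) → G) :
    (0 : Fin (m + 2)).contractNth (· * ·) (Fin.cons g x : Fin (m + 2) → G)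
      = (Fin.cons (g * x 0) (fun i : Fin m => x i.succ) : Fin (m + 1) → G) := by
  funext i
  refine Fin.cases ?_ (fun i => ?_) i
  · simp [Fin.contractNth]
  · simp [Fin.contractNth]

theorem contractNth_succ_cons_aux [Group G] (m : ℕ) (k : Fin (m + 1)) (g : G)
    (x : Fin (m + 1) → G) :
    (k.succ : Fin (m + 2)).contractNth (· * ·) (Fin.cons g x : Fin (m + 2) → G)
      = (Fin.cons g (k.contractNth (· * ·) x) : Fin (m + 1) → G) := by
  funext i
  refine Fin.cases ?_ (fun i => ?_) i
  · simp [Fin.contractNth]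
  · simp [Fin.contractNth, Fin.castSucc_succ]

theorem barHomotopy_single [Group G] [Fintype G] (m : ℕ) (x : Fin (m + 1) → G) :
    barD G (m + 1) (barH G (m + 1) (Finsupp.single x 1))
      + barH G m (barD G m (Finsupp.single x 1))
      = (Fintype.card G : ℤ) • Finsupp.single x 1 := by
  have hs : ∑ g : G, Finsupp.single (Fin.cons (g * x 0) (fun i : Fin m => x i.succ) :
      Fin (m + 1) → G) (1 : ℤ)
      = ∑ g : G, Finsupp.single (Fin.cons g (fun i : Fin m => x i.succ) :
      Fin (m + 1) → G) (1 : ℤ) :=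
    Equiv.sum_comp (Equiv.mulRight (x 0)) (fun g => Finsupp.single
      (Fin.cons g (fun i : Fin m => x i.succ) : Fin (m + 1) → G) (1 : ℤ))
  have h1 : barD G (m + 1) (barH G (m + 1) (Finsupp.single x 1))
      = (Fintype.card G : ℤ) • Finsupp.single x 1
        + (-(∑ g : G, Finsupp.single (Fin.cons g (fun i : Fin m => x i.succ) :
            Fin (m + 1) → G) (1 : ℤ))
        - ∑ g : G, ∑ k : Fin (m + 1), ((-1 : ℤ) ^ ((k : ℕ) + 1)) •
            Finsupp.single (Fin.cons g (k.contractNth (· * ·) x) : Fin (m + 1) → G) (1 : ℤ)) := by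
    rw [barH_single_aux, map_sum, ← hs, ← Finset.sum_neg_distrib, ← Finset.sum_sub_distrib]
    have hc : (Fintype.card G : ℤ) • Finsupp.single x (1 : ℤ)
        = ∑ _g : G, Finsupp.single x (1 : ℤ) := by
      simp
    rw [hc, ← Finset.sum_add_distrib]
    refine Finset.sum_congr rfl fun g _ => ?_
    rw [barD_single_aux, Fin.sum_univ_succ, contractNth_zero_cons_aux]
    simp only [contractNth_succ_cons_aux, Fin.cons_succ, Fin.val_succ, Fin.val_zero]
    rw [sub_eq_add_neg, ← Finset.sum_neg_distrib]
    congr 2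
    · simp
    · refine Finset.sum_congr rfl fun k _ => ?_
      rw [pow_succ _ ((k : ℕ) + 1), mul_neg_one, neg_smul]
  have h2 : barH G m (barD G m (Finsupp.single x 1))
      = (∑ g : G, Finsupp.single (Fin.cons g (fun i : Fin m => x i.succ) :
            Fin (m + 1) → G) (1 : ℤ))
        + ∑ g : G, ∑ k : Fin (m + 1), ((-1 : ℤ) ^ ((k : ℕ) + 1)) •
            Finsupp.single (Fin.cons g (k.contractNth (· * ·) x) : Fin (m + 1) → G) (1 : ℤ) := by
    rw [barD_single_aux, map_add, barH_single_aux, map_sum, Finset.sum_comm]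
    congr 1
    refine Finset.sum_congr rfl fun k _ => ?_
    rw [map_smul, barH_single_aux, Finset.smul_sum]
  rw [h1, h2]
  abel

theorem barHomotopy [Group G] [Fintype G] (m : ℕ) (C : (Fin (m + 1) → G) →₀ ℤ) :
    barD G (m + 1) (barH G (m + 1) C) + barH G m (barD G m C)
      = (Fintype.card G : ℤ) • C := by
  have h : (barD G (m + 1)).comp (barH G (m + 1)) + (barH G m).comp (barD G m)
      = (Fintype.card G : ℤ) • LinearMap.id := by
    apply Finsupp.lhom_ext
    intro x b
    have hb : Finsupp.single x b = b • Finsupp.single x (1 : ℤ) := by simp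
    rw [hb, map_smul, map_smul]
    congr 1
    exact barHomotopy_single m x
  exact LinearMap.congr_fun h C

theorem barD_barOne [Group G] (m : ℕ) (hodd : Odd (m + 1)) :
    barD G (m + 1) (barOne G (m + 2)) = barOne G (m + 1) := by
  have hk : ∀ j : Fin (m + 2), j.contractNth (· * ·) (fun _ => (1 : G))
      = fun _ : Fin (m + 1) => (1 : G) := by
    intro j
    funext i
    simp [Fin.contractNth]
  unfold barOne
  rw [barD_single_aux]
  simp only [hk]
  rw [← Finset.sum_smul, Fin.sum_univ_eq_sum_range (fun j => (-1 : ℤ) ^ (j + 1)) (m + 2)]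
  have h0 : ∑ j ∈ Finset.range (m + 2), (-1 : ℤ) ^ (j + 1) = 0 := by
    simp only [pow_succ, mul_neg_one]
    rw [Finset.sum_neg_distrib, neg_one_geom_sum, if_pos, neg_zero]
    exact hodd.add_one
  rw [h0]
  simp

theorem barNorm_eq [Group G] [Fintype G] {n : ℕ} (x : (Fin n → G) →₀ ℤ) :
    barNorm x = ∑ a, (x a).natAbs := by
  classical
  exact Finsupp.sum_fintype _ _ (by simp)

theorem barEps_eq [Group G] [Fintype G] {n : ℕ} (x : (Fin n → G) →₀ ℤ) :
    barEps x = ∑ a, x a := by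
  classical
  exact Finsupp.sum_fintype _ _ (by simp)

theorem barNorm_add_le [Group G] [Fintype G] {n : ℕ} (x y : (Fin n → G) →₀ ℤ) :
    barNorm (x + y) ≤ barNorm x + barNorm y := by
  classical
  rw [barNorm_eq, barNorm_eq, barNorm_eq, ← Finset.sum_add_distrib]
  exact Finset.sum_le_sum fun a _ => Int.natAbs_add_le _ _

theorem barNorm_smul [Group G] [Fintype G] {n : ℕ} (c : ℤ) (x : (Fin n → G) →₀ ℤ) :
    barNorm (c • x) = c.natAbs * barNorm x := by
  classical
  rw [barNorm_eq, barNorm_eq, Finset.mul_sum]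
  exact Finset.sum_congr rfl fun a _ => by simp [Int.natAbs_mul]

theorem barNorm_sum_le [Group G] [Fintype G] {n : ℕ} {ι : Type*} (s : Finset ι)
    (f : ι → ((Fin n → G) →₀ ℤ)) :
    barNorm (∑ i ∈ s, f i) ≤ ∑ i ∈ s, barNorm (f i) := by
  classical
  induction s using Finset.induction_on with
  | empty => simp [barNorm]
  | insert a s ha ih =>
    rw [Finset.sum_insert ha, Finset.sum_insert ha]
    exact (barNorm_add_le _ _).trans (by omega)

theorem barNorm_single_one [Group G] {n : ℕ} (x : Fin n → G) :
    barNorm (Finsupp.single x 1) = 1 := by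
  simp [barNorm]

theorem barNorm_barH_le [Group G] [Fintype G] (n : ℕ) (C : (Fin n → G) →₀ ℤ) :
    barNorm (barH G n C) ≤ Fintype.card G * barNorm C := by
  have h : barH G n C = ∑ a ∈ C.support,
      C a • ∑ g : G, Finsupp.single (Fin.cons g a : Fin (n + 1) → G) (1 : ℤ) := by
    rfl
  have h3 : barNorm C = ∑ a ∈ C.support, (C a).natAbs := rfl
  rw [h, h3, Finset.mul_sum]
  refine (barNorm_sum_le _ _).trans (Finset.sum_le_sum fun a _ => ?_)
  rw [barNorm_smul, mul_comm]
  refine Nat.mul_le_mul_right _ ((barNorm_sum_le _ _).trans ?_)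
  simp [barNorm_single_one]

theorem barEps_le [Group G] [Fintype G] {n : ℕ} (x : (Fin n → G) →₀ ℤ) :
    (barEps x).natAbs ≤ barNorm x := by
  classical
  rw [barEps_eq, barNorm_eq]
  exact Int.natAbs_sum_le _ _

end BarHelpers

/-- Let `G` be a finite abelian group and `n = m + 1` an odd positive
integer. For every cycle `C` in degree `n` of the unnormalized bar complex of `G` with
trivial `ℤ`-coefficients, there exist a positive integer `r ≤ |G| ^ ((n+1)·‖C‖₁)` and a
chain `u` in degree `n + 1` with `d u = r • C − (r · ε(C)) • e_n` and
`‖u‖₁ ≤ (n+1) · |G| ^ ((n+1)·‖C‖₁) · ‖C‖₁`. -/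
theorem bar_cycle_torsion_boundary_quantitative
    (G : Type*) [CommGroup G] [Fintype G] (m : ℕ) (hodd : Odd (m + 1))
    (C : (Fin (m + 1) → G) →₀ ℤ) (hC : barD G m C = 0) :
    ∃ (r : ℕ) (u : (Fin (m + 2) → G) →₀ ℤ), 0 < r ∧
      r ≤ Fintype.card G ^ ((m + 2) * barNorm C) ∧
      barD G (m + 1) u = (r : ℤ) • C - ((r : ℤ) * barEps C) • barOne G (m + 1) ∧
      barNorm u ≤ (m + 2) * Fintype.card G ^ ((m + 2) * barNorm C) * barNorm C := by
  by_cases h0 : barNorm C = 0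
  · have hC0 : C = 0 := by
      rw [barNorm_eq, Finset.sum_eq_zero_iff] at h0
      ext a
      simpa using h0 a (Finset.mem_univ a)
    subst hC0
    refine ⟨1, 0, one_pos, ?_, ?_, ?_⟩
    · simp [h0]
    · simp [barEps]
    · simp [barNorm]
  have hpos : 0 < Fintype.card G := Fintype.card_pos
  have hle : Fintype.card G ≤ Fintype.card G ^ ((m + 2) * barNorm C) :=
    Nat.le_self_pow (Nat.mul_ne_zero (by omega) h0) _
  refine ⟨Fintype.card G, barH G (m + 1) C +
    (-((Fintype.card G : ℤ) * barEps C)) • barOne G (m + 2), hpos, hle, ?_, ?_⟩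
  · have h := barHomotopy m C
    rw [hC, map_zero, add_zero] at h
    rw [map_add, map_smul, h, barD_barOne m hodd, neg_smul, sub_eq_add_neg]
  · have h1 := barNorm_barH_le (m + 1) C
    have h2 : barNorm ((-((Fintype.card G : ℤ) * barEps C)) • barOne G (m + 2))
        ≤ Fintype.card G * barNorm C := by
      rw [barNorm_smul, barOne, barNorm_single_one, mul_one, Int.natAbs_neg, Int.natAbs_mul,
        Int.natAbs_natCast]
      exact Nat.mul_le_mul_left _ (barEps_le C)
    refine (barNorm_add_le _ _).trans ?_
    calc _ ≤ 2 * Fintype.card G * barNorm C := by linarith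
      _ ≤ _ := Nat.mul_le_mul_right _ (Nat.mul_le_mul (by omega) hle)
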